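/- Two nilpotent representations φ, ψ ∈ E_nilp(d) of the cyclic quiver Δ_n^{(1)} lie in the same G_d-orbit if and only if for every i ∈ ℤ/nℤ and every l ≥ 1 one has rank(φ_{i+l−1} ∘ ⋯ ∘ φ_{i+1} ∘ φ_i) = rank(ψ_{i+l−1} ∘ ⋯ ∘ ψ_{i+1} ∘ ψ_i). (This realizes the parametrization of G_d-orbits in E_nilp(d) by n-multisegments.) -/

import Mathlib

open Module LinearMap Finset

/-- The vertex of the cyclic quiver reached from vertex `i` after `t` steps. -/
def vtx (n : ℕ) (i : ZMod n) : ℕ → ZMod n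
  | 0 => i
  | t + 1 => vtx n i t + 1

/-- The composition `φ_{i+t-1} ∘ ⋯ ∘ φ_{i+1} ∘ φ_i` of `t` consecutive structure
maps of a representation of the cyclic quiver, starting at vertex `i`. -/
def ccomps {k : Type*} [Field k] {n : ℕ} (d : ZMod n → ℕ)
    (φ : ∀ i : ZMod n, (Fin (d i) → k) →ₗ[k] (Fin (d (i + 1)) → k)) (i : ZMod n) :
    ∀ t : ℕ, (Fin (d i) → k) →ₗ[k] (Fin (d (vtx n i t)) → k)
  | 0 => LinearMap.id
  | t + 1 => (φ (vtx n i t)).comp (ccomps d φ i t)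

/-- A representation of the cyclic quiver is nilpotent:
`φ_{i+N-1} ∘ ⋯ ∘ φ_i = 0` for all `i` and all sufficiently large `N`. -/
def IsNilpotentRep {k : Type*} [Field k] {n : ℕ} (d : ZMod n → ℕ)
    (φ : ∀ i : ZMod n, (Fin (d i) → k) →ₗ[k] (Fin (d (i + 1)) → k)) : Prop :=
  ∃ N₀ : ℕ, ∀ (i : ZMod n) (N : ℕ), N₀ ≤ N → ccomps d φ i N = 0

/-- Two points of the representation space of the cyclic quiver lie in the same
orbit of `G_d = ∏_{i ∈ ℤ/nℤ} GL_{dᵢ}(k)`, acting by `(g·φ)ᵢ = gᵢ₊₁ ∘ φᵢ ∘ gᵢ⁻¹`. -/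
def sameOrbitC (k : Type*) [Field k] {n : ℕ} (d : ZMod n → ℕ)
    (φ ψ : ∀ i : ZMod n, (Fin (d i) → k) →ₗ[k] (Fin (d (i + 1)) → k)) : Prop :=
  ∃ g : ∀ i : ZMod n, (Fin (d i) → k) ≃ₗ[k] (Fin (d i) → k),
    ∀ i, ψ i = (g (i + 1)).toLinearMap ∘ₗ φ i ∘ₗ ((g i).symm).toLinearMap

section LinearAlgebra

variable {k V V' U U' : Type*} [Field k] [AddCommGroup V] [Module k V] [AddCommGroup V']
  [Module k V'] [AddCommGroup U] [Module k U] [AddCommGroup U'] [Module k U']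

/-- An injective linear map on a subspace extends to an injective linear map as soon as the
dimensions allow it. -/
theorem exists_injective_extend [FiniteDimensional k V] [FiniteDimensional k V']
    (S : Submodule k V) (g : S →ₗ[k] V') (hg : Function.Injective g)
    (hd : finrank k V ≤ finrank k V') :
    ∃ f : V →ₗ[k] V', Function.Injective f ∧ ∀ s : S, f s = g s := by
  obtain ⟨C, hC⟩ := S.exists_isCompl
  obtain ⟨C', hC'⟩ := (LinearMap.range g).exists_isCompl
  have h1 := Submodule.finrank_add_eq_of_isCompl hC
  have h2 := Submodule.finrank_add_eq_of_isCompl hC'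
  have h3 := LinearMap.finrank_range_of_inj hg
  obtain ⟨e, he⟩ := finrank_le_iff_exists_linearMap.1
    (show finrank k C ≤ finrank k C' by omega)
  refine ⟨LinearMap.ofIsCompl hC g (C'.subtype ∘ₗ e), ?_, fun s => by simp⟩
  rw [← LinearMap.ker_eq_bot, LinearMap.ker_eq_bot']
  intro v hv
  obtain ⟨s, c, rfl, -⟩ := Submodule.existsUnique_add_of_isCompl hC v
  simp only [map_add, LinearMap.ofIsCompl_apply_left, LinearMap.ofIsCompl_apply_right,
    LinearMap.comp_apply, Submodule.subtype_apply] at hv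
  have hmem : g s ∈ C' := by
    rw [eq_neg_of_add_eq_zero_left hv]
    exact C'.neg_mem (e c).2
  have hs0 : g s = 0 := Submodule.disjoint_def.1 hC'.disjoint _ ⟨s, rfl⟩ hmem
  rw [hs0, zero_add] at hv
  have hs : s = 0 := hg (by rw [hs0, map_zero])
  have hc : c = 0 := he (by rw [map_zero]; exact Subtype.ext hv)
  simp [hs, hc]

/-- A linear map on a subspace which is compatible with `h : U → U'` along `p : V → U` and a
surjection `p' : V' → U'` extends to a compatible linear map on the whole space. -/
theorem exists_lift_extend (D : Submodule k V) (g : D →ₗ[k] V')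
    (p : V →ₗ[k] U) (p' : V' →ₗ[k] U') (hp' : Function.Surjective p') (h : U →ₗ[k] U')
    (hc : ∀ x : D, p' (g x) = h (p x)) :
    ∃ f : V →ₗ[k] V', (∀ x : D, f x = g x) ∧ ∀ v, p' (f v) = h (p v) := by
  obtain ⟨F, hF⟩ := LinearMap.exists_extend g
  obtain ⟨s, hs⟩ := LinearMap.exists_rightInverse_of_surjective p' (LinearMap.range_eq_top.2 hp')
  replace hF (x : D) : F x = g x := LinearMap.congr_fun hF x
  replace hs (u : U') : p' (s u) = u := LinearMap.congr_fun hs u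
  refine ⟨F - s ∘ₗ (p' ∘ₗ F - h ∘ₗ p), fun x => ?_, fun v => ?_⟩
  · simp [hF, hc]
  · simp [hs]

/-- An injective linear map on a subspace which is compatible with an injection `h : U → U'` along
`p : V → U` and a surjection `p' : V' → U'` extends to a compatible injective linear map on the
whole space, as soon as the dimensions of the kernels allow it. -/
theorem exists_injective_lift_extend [FiniteDimensional k V] [FiniteDimensional k V']
    (W : Submodule k V) (g : W →ₗ[k] V') (hg : Function.Injective g)
    (p : V →ₗ[k] U) (p' : V' →ₗ[k] U') (hp' : Function.Surjective p')
    (h : U →ₗ[k] U') (hh : Function.Injective h) (hc : ∀ w : W, p' (g w) = h (p w))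
    (hd : finrank k (LinearMap.ker p) ≤ finrank k (LinearMap.ker p')) :
    ∃ f : V →ₗ[k] V', Function.Injective f ∧ (∀ w : W, f w = g w) ∧
      ∀ v, p' (f v) = h (p v) := by
  let K := LinearMap.ker p
  let S : Submodule k K := W.comap K.subtype
  let ι : S →ₗ[k] W := (K.subtype ∘ₗ S.subtype).codRestrict W fun s => s.2
  let gS : S →ₗ[k] LinearMap.ker p' := (g ∘ₗ ι).codRestrict _ fun s => by
    have : p (ι s) = 0 := s.1.2
    simp [hc, this]
  have hgS : Function.Injective gS := by
    intro a b hab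
    have : ι a = ι b := hg (congrArg Subtype.val hab)
    exact Subtype.ext (Subtype.ext (congrArg (fun w : W => (w : V)) this))
  obtain ⟨κ, hκ, hκS⟩ := exists_injective_extend S gS hgS hd
  let f₁ : V →ₗ.[k] V' := ⟨W, g⟩
  let f₂ : V →ₗ.[k] V' := ⟨K, (LinearMap.ker p').subtype ∘ₗ κ⟩
  have hagree : ∀ (x : f₁.domain) (y : f₂.domain), (x : V) = y → f₁ x = f₂ y := by
    rintro ⟨x, hx⟩ ⟨y, hy⟩ hxy
    obtain rfl : x = y := hxy
    exact (congrArg Subtype.val (hκS ⟨⟨x, hy⟩, hx⟩)).symm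
  have hL (w : W) (hw : (w : V) ∈ (f₁.sup f₂ hagree).domain) :
      (f₁.sup f₂ hagree) ⟨w, hw⟩ = g w :=
    ((LinearPMap.left_le_sup f₁ f₂ hagree).2 (x := w) (y := ⟨w, hw⟩) rfl).symm
  have hR (w : K) (hw : (w : V) ∈ (f₁.sup f₂ hagree).domain) :
      (f₁.sup f₂ hagree) ⟨w, hw⟩ = κ w :=
    ((LinearPMap.right_le_sup f₁ f₂ hagree).2 (x := w) (y := ⟨w, hw⟩) rfl).symm
  have hW : W ≤ (f₁.sup f₂ hagree).domain := (LinearPMap.left_le_sup f₁ f₂ hagree).1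
  have hK : K ≤ (f₁.sup f₂ hagree).domain := (LinearPMap.right_le_sup f₁ f₂ hagree).1
  obtain ⟨f, hf, hfp⟩ := exists_lift_extend _ (f₁.sup f₂ hagree).toFun p p' hp' h (by
    rintro ⟨x, hx⟩
    obtain ⟨a, ha, b, hb, rfl⟩ := Submodule.mem_sup.1 hx
    have hsum : (f₁.sup f₂ hagree).toFun ⟨a + b, hx⟩ =
        (f₁.sup f₂ hagree).toFun ⟨a, hW ha⟩ + (f₁.sup f₂ hagree).toFun ⟨b, hK hb⟩ :=
      map_add (f₁.sup f₂ hagree).toFun ⟨a, hW ha⟩ ⟨b, hK hb⟩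
    have e1 : (f₁.sup f₂ hagree).toFun ⟨a, hW ha⟩ = g ⟨a, ha⟩ := hL ⟨a, ha⟩ _
    have e2 : (f₁.sup f₂ hagree).toFun ⟨b, hK hb⟩ = κ ⟨b, hb⟩ := hR ⟨b, hb⟩ _
    have hb0 : p b = 0 := hb
    have hκ0 : p' (κ ⟨b, hb⟩) = 0 := (κ ⟨b, hb⟩).2
    rw [hsum, e1, e2]
    simp [hc, hκ0, show p (a + b) = p a by rw [map_add, hb0, add_zero]])
  refine ⟨f, ?_, fun w => (hf ⟨w, hW w.2⟩).trans (hL w _), hfp⟩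
  rw [← LinearMap.ker_eq_bot, LinearMap.ker_eq_bot']
  intro v hv
  have hvK : v ∈ K := by
    refine hh ?_
    rw [← hfp, hv, map_zero, map_zero]
  have hv' : (κ ⟨v, hvK⟩ : V') = 0 := by
    rw [← hv]
    exact ((hf ⟨v, hK hvK⟩).trans (hR ⟨v, hvK⟩ _)).symm
  have : (⟨v, hvK⟩ : K) = 0 := hκ (by rw [map_zero]; exact Subtype.ext hv')
  exact congrArg Subtype.val this

end LinearAlgebra

section IteratedImage

variable {k : Type*} [Field k] {n : ℕ} {d : ZMod n → ℕ}
  (φ ψ : ∀ i : ZMod n, (Fin (d i) → k) →ₗ[k] (Fin (d (i + 1)) → k))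

/-- The structure map of a representation of the cyclic quiver, with a flexible target vertex. -/
def arrowMap (i j : ZMod n) (h : i + 1 = j) : (Fin (d i) → k) →ₗ[k] (Fin (d j) → k) :=
  h ▸ φ i

/-- The image at the vertex `j` of the composition of the `l` structure maps leading to `j`. -/
def iterImage : ℕ → ∀ j : ZMod n, Submodule k (Fin (d j) → k)
  | 0, _ => ⊤
  | l + 1, j => (iterImage l (j - 1)).map (arrowMap φ (j - 1) j (sub_add_cancel j 1))

theorem iterImage_succ (l : ℕ) (i : ZMod n) :
    iterImage φ (l + 1) (i + 1) = (iterImage φ l i).map (φ i) := by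
  have key : ∀ i' (h : i' + 1 = i + 1),
      (iterImage φ l i').map (arrowMap φ i' (i + 1) h) = (iterImage φ l i).map (φ i) := by
    intro i' h
    obtain rfl := add_right_cancel h
    rfl
  exact key _ _

theorem iterImage_succ_le (l : ℕ) : ∀ j : ZMod n, iterImage φ (l + 1) j ≤ iterImage φ l j := by
  induction l with
  | zero => exact fun j => le_top
  | succ l ih => exact fun j => Submodule.map_mono (ih _)

theorem apply_mem_iterImage_succ {l : ℕ} {i : ZMod n} {x : Fin (d i) → k}
    (hx : x ∈ iterImage φ l i) : φ i x ∈ iterImage φ (l + 1) (i + 1) := by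
  rw [iterImage_succ]
  exact Submodule.mem_map_of_mem hx

theorem range_ccomps (i : ZMod n) (l : ℕ) :
    LinearMap.range (ccomps d φ i l) = iterImage φ l (vtx n i l) := by
  induction l with
  | zero => exact LinearMap.range_id
  | succ l ih =>
    change LinearMap.range ((φ (vtx n i l)).comp (ccomps d φ i l)) =
      iterImage φ (l + 1) (vtx n i l + 1)
    rw [LinearMap.range_comp, ih, iterImage_succ]

theorem exists_vtx_eq (j : ZMod n) (l : ℕ) : ∃ i, vtx n i l = j := by
  induction l generalizing j with
  | zero => exact ⟨j, rfl⟩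
  | succ l ih =>
    obtain ⟨i, hi⟩ := ih (j - 1)
    exact ⟨i, by rw [vtx, hi, sub_add_cancel]⟩

/-- The map `φ i` from the `l`-th iterated image at `i` to the next one at `i + 1`. -/
def iterImageMap (l : ℕ) (i : ZMod n) : iterImage φ l i →ₗ[k] iterImage φ (l + 1) (i + 1) :=
  (φ i).restrict fun _ => apply_mem_iterImage_succ φ

theorem iterImageMap_surjective (l : ℕ) (i : ZMod n) :
    Function.Surjective (iterImageMap φ l i) := by
  rintro ⟨y, hy⟩
  rw [iterImage_succ] at hy
  obtain ⟨x, hx, rfl⟩ := hy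
  exact ⟨⟨x, hx⟩, rfl⟩

theorem finrank_ker_iterImageMap (l : ℕ) (i : ZMod n) :
    finrank k (iterImage φ (l + 1) (i + 1)) + finrank k (LinearMap.ker (iterImageMap φ l i)) =
      finrank k (iterImage φ l i) := by
  rw [← LinearMap.finrank_range_add_finrank_ker (iterImageMap φ l i),
    LinearMap.range_eq_top.2 (iterImageMap_surjective φ l i), finrank_top]

/-- A morphism between the subrepresentations of `l`-th iterated images that is injective at each
vertex. -/
def HasIterImageEmbedding (l : ℕ) : Prop :=
  ∃ g : ∀ j, iterImage φ l j →ₗ[k] iterImage ψ l j, (∀ j, Function.Injective (g j)) ∧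
    ∀ (i : ZMod n) (x : iterImage φ l i) (y : iterImage φ l (i + 1)),
      φ i x = y → ψ i (g i x) = g (i + 1) y

variable {φ ψ}

theorem HasIterImageEmbedding.of_succ {l : ℕ}
    (hr : ∀ l j, finrank k (iterImage φ l j) = finrank k (iterImage ψ l j))
    (H : HasIterImageEmbedding φ ψ (l + 1)) : HasIterImageEmbedding φ ψ l := by
  obtain ⟨g, hg, hc⟩ := H
  have key (j : ZMod n) : ∃ f : iterImage φ l j →ₗ[k] iterImage ψ l j, Function.Injective f ∧
      (∀ (x : iterImage φ l j) (y : iterImage φ (l + 1) j), (x : Fin (d j) → k) = y →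
        (f x : Fin (d j) → k) = g j y) ∧
      ∀ x, iterImageMap ψ l j (f x) = g (j + 1) (iterImageMap φ l j x) := by
    let W : Submodule k (iterImage φ l j) :=
      (iterImage φ (l + 1) j).comap (iterImage φ l j).subtype
    let ι : W →ₗ[k] iterImage φ (l + 1) j :=
      ((iterImage φ l j).subtype ∘ₗ W.subtype).codRestrict _ fun w => w.2
    have hι : Function.Injective ι := fun a b hab =>
      Subtype.ext (Subtype.ext
        (congrArg (fun y : iterImage φ (l + 1) j => (y : Fin (d j) → k)) hab))
    obtain ⟨f, hf, hfW, hfp⟩ := exists_injective_lift_extend W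
      (Submodule.inclusion (iterImage_succ_le ψ l j) ∘ₗ g j ∘ₗ ι)
      ((Submodule.inclusion_injective (iterImage_succ_le ψ l j)).comp ((hg j).comp hι))
      (iterImageMap φ l j) (iterImageMap ψ l j) (iterImageMap_surjective ψ l j)
      (g (j + 1)) (hg (j + 1))
      (fun w => Subtype.ext (hc j (ι w)
        ⟨φ j w, apply_mem_iterImage_succ φ w.1.2⟩ rfl))
      (by
        have h1 := finrank_ker_iterImageMap φ l j
        have h2 := finrank_ker_iterImageMap ψ l j
        have h3 := hr l j
        have h4 := hr (l + 1) (j + 1)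
        omega)
    refine ⟨f, hf, ?_, hfp⟩
    rintro ⟨x, hx⟩ ⟨y, hy⟩ hxy
    obtain rfl : x = y := hxy
    exact congrArg Subtype.val (hfW ⟨⟨x, hx⟩, hy⟩)
  choose f hf hfg hfp using key
  refine ⟨f, hf, fun i x y hxy => ?_⟩
  rw [hfg (i + 1) y (iterImageMap φ l i x) hxy.symm, ← hfp]
  rfl

theorem hasIterImageEmbedding_zero {N : ℕ}
    (hr : ∀ l j, finrank k (iterImage φ l j) = finrank k (iterImage ψ l j))
    (hN : ∀ j, iterImage φ N j = ⊥) : HasIterImageEmbedding φ ψ 0 := by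
  refine Nat.decreasingInduction (motive := fun l _ => HasIterImageEmbedding φ ψ l)
    (fun l _ H => H.of_succ hr) ?_ (Nat.zero_le N)
  have (j : ZMod n) : Subsingleton (iterImage φ N j) :=
    Submodule.subsingleton_iff_eq_bot.2 (hN j)
  exact ⟨0, fun j => Function.injective_of_subsingleton _, fun i x y _ => by simp⟩

theorem HasIterImageEmbedding.sameOrbitC (H : HasIterImageEmbedding φ ψ 0) :
    sameOrbitC k d φ ψ := by
  obtain ⟨g, hg, hc⟩ := H
  let e (j : ZMod n) : (Fin (d j) → k) →ₗ[k] (Fin (d j) → k) :=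
    (iterImage ψ 0 j).subtype ∘ₗ g j ∘ₗ LinearMap.id.codRestrict (iterImage φ 0 j)
      fun _ => Submodule.mem_top
  have he (j : ZMod n) : Function.Injective (e j) := fun a b hab =>
    congrArg Subtype.val (hg j (Subtype.ext hab))
  refine ⟨fun j => LinearEquiv.ofInjectiveEndo (e j) (he j), fun i => ?_⟩
  rw [← LinearMap.comp_assoc, LinearEquiv.eq_comp_toLinearMap_symm]
  exact LinearMap.ext fun y => hc i ⟨_, Submodule.mem_top⟩ ⟨_, Submodule.mem_top⟩ rfl

theorem sameOrbitC.finrank_range_ccomps_eq (H : sameOrbitC k d φ ψ) (i : ZMod n) (l : ℕ) :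
    finrank k (LinearMap.range (ccomps d φ i l)) =
      finrank k (LinearMap.range (ccomps d ψ i l)) := by
  obtain ⟨g, hg⟩ := H
  have hconj : ccomps d ψ i l ∘ₗ (g i).toLinearMap =
      (g (vtx n i l)).toLinearMap ∘ₗ ccomps d φ i l := by
    induction l with
    | zero => rfl
    | succ l ih =>
      change (ψ (vtx n i l) ∘ₗ ccomps d ψ i l) ∘ₗ (g i).toLinearMap =
        (g (vtx n i l + 1)).toLinearMap ∘ₗ φ (vtx n i l) ∘ₗ ccomps d φ i l
      rw [LinearMap.comp_assoc, ih, hg (vtx n i l)]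
      refine LinearMap.ext fun x => ?_
      simp
  rw [← LinearEquiv.range_comp (g i) (ccomps d ψ i l), hconj, LinearMap.range_comp]
  exact (LinearEquiv.finrank_map_eq (g (vtx n i l)) _).symm

end IteratedImage

/-- Two nilpotent representations `φ, ψ ∈ E_nilp(d)` of the cyclic quiver lie in
the same `G_d`-orbit if and only if for every vertex `i ∈ ℤ/nℤ` and every
`l ≥ 1` one has `rank(φ_{i+l-1} ∘ ⋯ ∘ φ_i) = rank(ψ_{i+l-1} ∘ ⋯ ∘ ψ_i)`. -/
theorem orbits_classified_by_ranks_cyclic_quiver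
    (k : Type*) [Field k] (n : ℕ) (hn : 1 ≤ n) (d : ZMod n → ℕ)
    (φ ψ : ∀ i : ZMod n, (Fin (d i) → k) →ₗ[k] (Fin (d (i + 1)) → k))
    (hφ : IsNilpotentRep d φ) (hψ : IsNilpotentRep d ψ) :
    sameOrbitC k d φ ψ ↔
      ∀ (i : ZMod n) (l : ℕ), 1 ≤ l →
        finrank k (LinearMap.range (ccomps d φ i l))
          = finrank k (LinearMap.range (ccomps d ψ i l)) := by
  refine ⟨fun H i l _ => H.finrank_range_ccomps_eq i l, fun hr => ?_⟩
  obtain ⟨N, hN⟩ := hφ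
  refine HasIterImageEmbedding.sameOrbitC (hasIterImageEmbedding_zero (N := N) ?_ ?_)
  · intro l j
    obtain ⟨i, rfl⟩ := exists_vtx_eq j l
    rcases Nat.eq_zero_or_pos l with rfl | hl
    · rfl
    · rw [← range_ccomps, ← range_ccomps, hr i l hl]
  · intro j
    obtain ⟨i, rfl⟩ := exists_vtx_eq j N
    rw [← range_ccomps, hN i N le_rfl, LinearMap.range_zero]
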